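/- Given a weighted graph G(V,E) without self-loops whose (weighted) node degrees are all even integers, there exists a graph on the same vertex set, without self-loops, with integer edge weights n'_e satisfying n'_e ∈ {⌊n_e⌋, ⌊n_e⌋ + 1} for every edge e, and whose node degrees equal those of G. -/

import Mathlib

/-- A symmetric integer matrix with zero diagonal and entries `0` or `1`. -/
structure IsZeroOneAdj {V : Type*} (A : V → V → ℤ) : Prop where
  symm : ∀ u v, A u v = A v u
  diag : ∀ v, A v v = 0
  zero_or_one : ∀ u v, A u v = 0 ∨ A u v = 1

/-- Overwrite the entries of `A` at `(a, b)` and `(b, a)` by `t`. -/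
def setEdge {V : Type*} [DecidableEq V] (A : V → V → ℤ) (a b : V) (t : ℤ) : V → V → ℤ :=
  fun u v => if (u = a ∧ v = b) ∨ (u = b ∧ v = a) then t else A u v

/-- The sum of the entries of `A` in row `v`. -/
def rowSum {V : Type*} [Fintype V] (A : V → V → ℤ) (v : V) : ℤ := ∑ u, A v u

section setEdge

variable {V : Type*} [DecidableEq V] {A : V → V → ℤ}

theorem IsZeroOneAdj.setEdge (hA : IsZeroOneAdj A) {a b : V} (hab : a ≠ b) {t : ℤ}
    (ht : t = 0 ∨ t = 1) : IsZeroOneAdj (setEdge A a b t) where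
  symm u v := by
    have := hA.symm u v
    unfold _root_.setEdge
    grind
  diag v := by
    have := hA.diag v
    unfold _root_.setEdge
    grind
  zero_or_one u v := by
    have := hA.zero_or_one u v
    unfold _root_.setEdge
    grind

theorem IsZeroOneAdj.sum_setEdge [Fintype V] (hA : IsZeroOneAdj A) {a b : V} (hab : a ≠ b)
    (t : ℤ) (v : V) :
    rowSum (_root_.setEdge A a b t) v =
      rowSum A v + (if v = a ∨ v = b then t - A a b else 0) := by
  have h : ∀ u, _root_.setEdge A a b t v u = A v u +
      ((if u = b then (if v = a then t - A a b else 0) else 0) +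
        (if u = a then (if v = b then t - A a b else 0) else 0)) := by
    intro u
    have := hA.symm a b
    unfold _root_.setEdge
    grind
  simp only [rowSum, h, Finset.sum_add_distrib, Finset.sum_ite_eq', Finset.mem_univ, if_true]
  grind

end setEdge

theorem even_sum_sum_of_symm {V : Type*} [Fintype V] (A : V → V → ℤ)
    (hsymm : ∀ u v, A u v = A v u) (hdiag : ∀ v, A v v = 0) :
    Even (∑ v, rowSum A v) := by
  unfold rowSum
  rw [← ZMod.intCast_eq_zero_iff_even, ← Fintype.sum_prod_type', Int.cast_sum]
  refine Finset.sum_involution (fun p _ => p.swap) ?_ ?_ (fun _ _ => Finset.mem_univ _)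
    (fun _ _ => Prod.swap_swap _)
  · rintro ⟨u, v⟩ -
    simp only [Prod.swap]
    rw [hsymm v u]
    exact CharTwo.add_self_eq_zero _
  · rintro ⟨u, v⟩ - h heq
    simp only [Prod.swap, Prod.mk.injEq] at heq
    apply h
    simp [heq.1, hdiag]

/-- `A` has row sums at most `f`, with equality on `P`, and no edges avoiding `insert r P`. -/
structure IsPartialRealization {V : Type*} [Fintype V] (f : V → ℤ) (P : Finset V) (r : V)
    (A : V → V → ℤ) : Prop where
  adj : IsZeroOneAdj A
  eq : ∀ v ∈ P, rowSum A v = f v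
  le : ∀ v, rowSum A v ≤ f v
  indep : ∀ u v, u ∉ P → v ∉ P → u ≠ r → v ≠ r → A u v = 0

section Realization

variable {V : Type*} [Fintype V] [DecidableEq V] {f : V → ℤ} {P : Finset V} {r : V}
  {A : V → V → ℤ} {x : V → V → ℝ}

theorem IsZeroOneAdj.exists_of_sum_lt (hA : IsZeroOneAdj A) {i : V} (hir : i ≠ r)
    (h : rowSum A r < rowSum A i) :
    ∃ u, u ≠ r ∧ u ≠ i ∧ A i u = 1 ∧ A r u = 0 := by
  by_contra! hcon
  have hle : ∀ u ∈ (Finset.univ.erase r).erase i, A i u ≤ A r u := by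
    intro u hu
    have := hA.zero_or_one i u
    have := hA.zero_or_one r u
    have := hcon u
    grind
  have h1 := Finset.sum_le_sum hle
  have h2 : ∀ j, rowSum A j = ∑ u ∈ (Finset.univ.erase r).erase i, A j u + A j i + A j r := by
    intro j
    rw [rowSum, Finset.sum_erase_add _ _ (by simp [hir]), Finset.sum_erase_add _ _ (by simp)]
  rw [h2 r, h2 i, hA.diag, hA.diag, hA.symm i r] at h
  linarith

namespace IsPartialRealization

theorem sum_le_sum_rowSum (hA : IsPartialRealization f P r A)
    (hx0 : ∀ u v, 0 ≤ x u v) (hx1 : ∀ u v, x u v ≤ 1) (hxd : ∀ v, x v v = 0)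
    (hxs : ∀ u v, x u v = x v u) (hxf : ∀ v, ∑ u, x v u = f v)
    (hclique : ∀ i ∈ insert r P, ∀ j ∈ insert r P, i ≠ j → A i j = 1)
    (hout : ∀ k ∉ insert r P, rowSum A k < f k → ∀ i ∈ insert r P, A k i = 1) :
    ∑ i ∈ insert r P, f i ≤ ∑ i ∈ insert r P, rowSum A i := by
  obtain ⟨adj, -, le, indep⟩ := hA
  have symm := adj.symm
  have diag := adj.diag
  have key : ∑ i ∈ insert r P, ∑ u, x i u ≤ ∑ i ∈ insert r P, ∑ u, (A i u : ℝ) := by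
    simp only [← Finset.sum_add_sum_compl (insert r P) (fun u => x _ u),
      ← Finset.sum_add_sum_compl (insert r P) (fun u => (A _ u : ℝ)), Finset.sum_add_distrib]
    refine add_le_add (Finset.sum_le_sum fun i hi => Finset.sum_le_sum fun u hu => ?_) ?_
    · by_cases hiu : i = u
      · subst hiu
        simp [hxd, diag]
      · have : A i u = 1 := hclique i hi u hu hiu
        simp [this, hx1]
    · rw [Finset.sum_comm, Finset.sum_comm (f := fun i u => (A i u : ℝ))]
      refine Finset.sum_le_sum fun u hu => ?_
      simp only [hxs _ u, symm _ u]
      have hu' : u ∉ P ∧ u ≠ r := by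
        rw [Finset.mem_compl] at hu
        grind
      rcases (le u).lt_or_eq with h | h
      · refine Finset.sum_le_sum fun i hi => ?_
        simp [hout u (Finset.mem_compl.1 hu) h i hi, hx1]
      · calc ∑ i ∈ insert r P, x u i ≤ ∑ i, x u i :=
              Finset.sum_le_univ_sum_of_nonneg (hx0 u)
          _ = ((∑ i, A u i : ℤ) : ℝ) := by rw [← rowSum, hxf, h]
          _ = ((∑ i ∈ insert r P, A u i : ℤ) : ℝ) := by
              congr 1
              symm
              apply Finset.sum_subset (Finset.subset_univ _)
              intro i _ hi
              exact indep u i hu'.1 (by grind) hu'.2 (by grind)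
          _ = ∑ i ∈ insert r P, (A u i : ℝ) := by push_cast; rfl
  simp only [hxf] at key
  unfold rowSum
  exact_mod_cast key

set_option maxHeartbeats 1600000 in
theorem exists_lt (hA : IsPartialRealization f P r A) (hr : r ∉ P) (hP : ∀ p ∈ P, f r ≤ f p)
    (hx0 : ∀ u v, 0 ≤ x u v) (hx1 : ∀ u v, x u v ≤ 1) (hxd : ∀ v, x v v = 0)
    (hxs : ∀ u v, x u v = x v u) (hxf : ∀ v, ∑ u, x v u = f v) (heven : Even (∑ v, f v))
    (hlt : rowSum A r < f r) :
    ∃ A', IsPartialRealization f P r A' ∧ rowSum A r < rowSum A' r := by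
  by_contra! hno
  obtain ⟨adj, eq, le, indep⟩ := hA
  have symm := adj.symm
  have diag := adj.diag
  have z1 := adj.zero_or_one
  have sat_of_nonadj : ∀ k, k ≠ r → A r k = 0 → rowSum A k = f k := by
    intro k hk h0
    by_contra hne
    have s1 := adj.sum_setEdge hk.symm 1
    have := hno (setEdge A r k 1) ⟨adj.setEdge hk.symm (by simp), by grind, by grind,
      by unfold setEdge; grind⟩
    grind
  have exch : ∀ i ∈ P, ∃ u, u ≠ r ∧ u ≠ i ∧ A i u = 1 ∧ A r u = 0 := fun i hi =>
    adj.exists_of_sum_lt (by grind) (by grind)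
  have adj_r : ∀ i ∈ P, A r i = 1 := by
    intro i hi
    by_contra hne
    have h0 : A r i = 0 := by grind
    obtain ⟨u, hur, hui, hiu, hru⟩ := exch i hi
    have hir : i ≠ r := by grind
    have a1 := adj.setEdge hui (t := 0) (by simp)
    have s1 := adj.sum_setEdge hui 0
    have a2 := a1.setEdge hur (t := 1) (by simp)
    have s2 := a1.sum_setEdge hur 1
    have a3 := a2.setEdge hir (t := 1) (by simp)
    have s3 := a2.sum_setEdge hir 1
    have e1 : A u i = 1 := by grind
    have e2 : setEdge A u i 0 u r = 0 := by unfold setEdge; grind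
    have e3 : setEdge (setEdge A u i 0) u r 1 i r = 0 := by unfold setEdge; grind
    by_cases h2 : rowSum A r + 2 ≤ f r
    · have := hno _ ⟨a3, by grind, by grind, by unfold setEdge; grind⟩
      grind
    · obtain ⟨k, hkP, hkr, hk⟩ : ∃ k, k ∉ P ∧ k ≠ r ∧ rowSum A k < f k := by
        by_contra! hc
        have hall : ∀ v, f v = rowSum A v + if v = r then 1 else 0 := by
          intro v
          have hle := le v
          rcases eq_or_ne v r with rfl | hv
          · rw [if_pos rfl]
            omega
          · rw [if_neg hv, add_zero]
            by_cases hvP : v ∈ P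
            · exact (eq v hvP).symm
            · exact (hc v hvP hv).antisymm hle
        have hsum : ∑ v, f v = ∑ v, rowSum A v + 1 := by
          simp [hall, Finset.sum_add_distrib]
        have := even_sum_sum_of_symm A symm diag
        grind
      have hrk : A r k = 1 := by grind
      have a4 := a3.setEdge hkr (t := 0) (by simp)
      have s4 := a3.sum_setEdge hkr 0
      have e4 : setEdge (setEdge (setEdge A u i 0) u r 1) i r 1 k r = 1 := by
        unfold setEdge; grind
      have := hno _ ⟨a4, by grind, by grind, by unfold setEdge; grind⟩
      grind
  have adj_out : ∀ k, k ∉ P → k ≠ r → rowSum A k < f k → ∀ i ∈ insert r P, A k i = 1 := by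
    intro k hkP hkr hk i hi
    have hrk : A r k = 1 := by grind
    by_contra hne
    have hiP : i ∈ P := by grind
    have hki : A k i = 0 := by grind
    have hki' : k ≠ i := by grind
    obtain ⟨u, hur, hui, hiu, hru⟩ := exch i hiP
    have a1 := adj.setEdge hui (t := 0) (by simp)
    have s1 := adj.sum_setEdge hui 0
    have a2 := a1.setEdge hur (t := 1) (by simp)
    have s2 := a1.sum_setEdge hur 1
    have a3 := a2.setEdge hki' (t := 1) (by simp)
    have s3 := a2.sum_setEdge hki' 1
    have e1 : A u i = 1 := by grind
    have e2 : setEdge A u i 0 u r = 0 := by unfold setEdge; grind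
    have e3 : setEdge (setEdge A u i 0) u r 1 k i = 0 := by unfold setEdge; grind
    have := hno _ ⟨a3, by grind, by grind, by unfold setEdge; grind⟩
    grind
  have clique : ∀ i ∈ P, ∀ j ∈ P, i ≠ j → A i j = 1 := by
    intro i hi j hj hij
    by_contra hne
    have h0 : A i j = 0 := by grind
    obtain ⟨u, hur, hui, hiu, hru⟩ := exch i hi
    obtain ⟨w, hwr, hwj, hjw, hrw⟩ := exch j hj
    have huP : u ∉ P := by grind
    have hwP : w ∉ P := by grind
    have a1 := adj.setEdge hui (t := 0) (by simp)
    have s1 := adj.sum_setEdge hui 0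
    have a2 := a1.setEdge hur (t := 1) (by simp)
    have s2 := a1.sum_setEdge hur 1
    have a3 := a2.setEdge hij (t := 1) (by simp)
    have s3 := a2.sum_setEdge hij 1
    have a4 := a3.setEdge hwj (t := 0) (by simp)
    have s4 := a3.sum_setEdge hwj 0
    have e1 : A u i = 1 := by grind
    have e2 : setEdge A u i 0 u r = 0 := by unfold setEdge; grind
    have e3 : setEdge (setEdge A u i 0) u r 1 i j = 0 := by unfold setEdge; grind
    have e4 : setEdge (setEdge (setEdge A u i 0) u r 1) i j 1 w j = 1 := by
      unfold setEdge; grind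
    have tot : ∀ v, rowSum (setEdge (setEdge (setEdge (setEdge A u i 0) u r 1) i j 1) w j 0) v =
        rowSum A v + (if v = r then 1 else 0) - (if v = w then 1 else 0) := by
      intro v
      rw [s4, e4, s3, e3, s2, e2, s1, e1]
      grind only
    clear s1 s2 s3 s4
    have := hno _ ⟨a4, fun v hv => by grind only, fun v => by grind only, by unfold setEdge; grind⟩
    grind
  have key := sum_le_sum_rowSum ⟨adj, eq, le, indep⟩ hx0 hx1 hxd hxs hxf
    (fun i hi j hj hij => by
      rcases Finset.mem_insert.1 hi with rfl | hi'
      · exact adj_r j ((Finset.mem_insert.1 hj).resolve_left hij.symm)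
      · rcases Finset.mem_insert.1 hj with rfl | hj'
        · rw [symm, adj_r i hi']
        · exact clique i hi' j hj' hij)
    (fun k hk => by
      rw [Finset.mem_insert, not_or] at hk
      exact adj_out k hk.2 hk.1)
  have : ∑ i ∈ insert r P, rowSum A i < ∑ i ∈ insert r P, f i :=
    Finset.sum_lt_sum (fun i _ => le i) ⟨r, by simp, hlt⟩
  linarith

theorem exists_sum_eq (hA : IsPartialRealization f P r A) (hr : r ∉ P)
    (hP : ∀ p ∈ P, f r ≤ f p)
    (hx0 : ∀ u v, 0 ≤ x u v) (hx1 : ∀ u v, x u v ≤ 1) (hxd : ∀ v, x v v = 0)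
    (hxs : ∀ u v, x u v = x v u) (hxf : ∀ v, ∑ u, x v u = f v) (heven : Even (∑ v, f v)) :
    ∃ A', IsPartialRealization f P r A' ∧ rowSum A' r = f r := by
  induction hk : (f r - rowSum A r).toNat using Nat.strong_induction_on generalizing A with
  | _ k ih =>
    rcases (hA.le r).lt_or_eq with h | h
    · obtain ⟨A', hA', hlt⟩ := hA.exists_lt hr hP hx0 hx1 hxd hxs hxf heven h
      exact ih _ (by omega) hA' rfl
    · exact ⟨A, hA, h⟩

end IsPartialRealization

/-- A symmetric matrix with zero diagonal, entries in `[0, 1]` and integer row sums of even total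
can be replaced by a zero-one matrix with the same row sums. -/
theorem exists_isZeroOneAdj_sum_eq
    (hx0 : ∀ u v, 0 ≤ x u v) (hx1 : ∀ u v, x u v ≤ 1) (hxd : ∀ v, x v v = 0)
    (hxs : ∀ u v, x u v = x v u) (hxf : ∀ v, ∑ u, x v u = f v) (heven : Even (∑ v, f v)) :
    ∃ A : V → V → ℤ, IsZeroOneAdj A ∧ ∀ v, rowSum A v = f v := by
  have hf0 : ∀ v, 0 ≤ f v := fun v => by
    have : (0 : ℝ) ≤ f v := hxf v ▸ Finset.sum_nonneg fun u _ => hx0 v u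
    exact_mod_cast this
  have main : ∀ k ≤ Fintype.card V, ∃ P : Finset V, P.card = k ∧
      (∀ p ∈ P, ∀ q ∉ P, f q ≤ f p) ∧ ∃ A : V → V → ℤ, IsZeroOneAdj A ∧
        (∀ v ∈ P, rowSum A v = f v) ∧ (∀ v, rowSum A v ≤ f v) ∧
        ∀ u v, u ∉ P → v ∉ P → A u v = 0 := by
    intro k
    induction k with
    | zero =>
      exact fun _ => ⟨∅, by simp, by simp, fun _ _ => 0, ⟨by simp, by simp, by simp⟩,
        by simp, by simpa [rowSum] using hf0, by simp⟩
    | succ k ih =>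
      intro hk
      obtain ⟨P, hPk, hP, A, adj, eq, le, indep⟩ := ih (by omega)
      have hne : Pᶜ.Nonempty := by
        rw [← Finset.card_pos, Finset.card_compl]
        omega
      obtain ⟨r, hr, hmax⟩ := Finset.exists_max_image Pᶜ f hne
      simp only [Finset.mem_compl] at hr hmax
      obtain ⟨A', hA', hsum⟩ := IsPartialRealization.exists_sum_eq (f := f) (P := P) (r := r)
        ⟨adj, eq, le, fun u v hu hv _ _ => indep u v hu hv⟩ hr (fun p hp => hP p hp r hr)
        hx0 hx1 hxd hxs hxf heven
      have := hA'.eq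
      have := hA'.indep
      exact ⟨insert r P, by simp [hr, hPk], by grind, A', hA'.adj, by grind, hA'.le, by grind⟩
  obtain ⟨P, hPk, -, A, adj, eq, -, -⟩ := main _ le_rfl
  rw [Finset.card_eq_iff_eq_univ] at hPk
  exact ⟨A, adj, fun v => eq v (by simp [hPk])⟩

end Realization


/-- Rounding theorem: a loopless weighted graph with even integer degrees admits an
integer rounding of edge weights (each to floor or floor+1) preserving all degrees. -/
theorem stmt0 {V : Type*} [Fintype V] [DecidableEq V]
    (n : V → V → ℝ)
    (hsym : ∀ u v, n u v = n v u)
    (hnonneg : ∀ u v, 0 ≤ n u v)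
    (hloop : ∀ v, n v v = 0)
    (hdeg : ∀ v, ∃ m : ℤ, (∑ u, n v u) = 2 * m) :
    ∃ n' : V → V → ℤ,
      (∀ u v, n' u v = n' v u) ∧
      (∀ v, n' v v = 0) ∧
      (∀ u v, n' u v = ⌊n u v⌋ ∨ n' u v = ⌊n u v⌋ + 1) ∧
      (∀ v, (∑ u, (n' v u : ℝ)) = ∑ u, n v u) := by
  have hfloor : ∀ u v, ⌊n u v⌋ = ⌊n v u⌋ := fun u v => by rw [hsym]
  choose m hm using hdeg
  obtain ⟨A, adj, hA⟩ := exists_isZeroOneAdj_sum_eq (x := fun u v => Int.fract (n u v))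
    (f := fun v => 2 * m v - ∑ u, ⌊n v u⌋) (fun _ _ => Int.fract_nonneg _)
    (fun _ _ => (Int.fract_lt_one _).le) (by simp [hloop]) (fun u v => by rw [hsym])
    (fun v => by
      simp only [Int.fract, Finset.sum_sub_distrib, hm]
      push_cast
      rfl)
    (by
      rw [Finset.sum_sub_distrib, ← Finset.mul_sum]
      exact (even_two_mul _).sub (even_sum_sum_of_symm _ hfloor (by simp [hloop])))
  refine ⟨fun u v => ⌊n u v⌋ + A u v, fun u v => by simp only [hfloor u v, adj.symm u v],
    fun v => by simp [hloop, adj.diag], fun u v => ?_, fun v => ?_⟩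
  · rcases adj.zero_or_one u v with h | h <;> simp [h]
  · have h := hA v
    rw [hm, ← Int.cast_sum, Finset.sum_add_distrib, ← rowSum, h]
    push_cast
    ring
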